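/- The quaternion rotation parameterization is surjective onto SO(3): for every 3×3 real matrix R with RᵀR = I and det R = 1, there exists a unit quaternion q = (q_v, q_s) such that R = (q_s² − ‖q_v‖²) I + 2 q_v q_vᵀ − 2 q_s [q_v×]. -/

import Mathlib

open Matrix

/-- The skew-symmetric cross-product matrix `[v×]` of `v ∈ ℝ³`. -/
def crossMat (v : Fin 3 → ℝ) : Matrix (Fin 3) (Fin 3) ℝ :=
  !![0, -v 2, v 1; v 2, 0, -v 0; -v 1, v 0, 0]

/-- The rotation matrix `A(q) = (qs² − ‖qv‖²) I + 2 qv qvᵀ − 2 qs [qv×]` associated to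
the quaternion with vector part `qv` and scalar part `qs`. -/
def quatRotMat (qv : Fin 3 → ℝ) (qs : ℝ) : Matrix (Fin 3) (Fin 3) ℝ :=
  (qs ^ 2 - qv ⬝ᵥ qv) • (1 : Matrix (Fin 3) (Fin 3) ℝ)
    + (2 : ℝ) • vecMulVec qv qv - (2 * qs) • crossMat qv


lemma rank_one_aux (K : Matrix (Fin 4) (Fin 4) ℝ)
    (h : ∀ i a b, K i a * K i b = K i i * K a b)
    (ht : K 0 0 + K 1 1 + K 2 2 + K 3 3 = 4) :
    ∃ q : Fin 4 → ℝ, ∀ a b, q a * q b = K a b / 4 := by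
  have hp : ∃ i, 0 < K i i := by
    by_contra! hn
    linarith [hn 0, hn 1, hn 2, hn 3]
  obtain ⟨i, hi⟩ := hp
  refine ⟨fun a => K i a / (2 * √(K i i)), fun a b => ?_⟩
  have hs : √(K i i) ^ 2 = K i i := Real.sq_sqrt hi.le
  have hs0 : 0 < √(K i i) := Real.sqrt_pos.2 hi
  have e : K i a / (2 * √(K i i)) * (K i b / (2 * √(K i i)))
      = (K i a * K i b) / (4 * √(K i i) ^ 2) := by
    field_simp
    ring
  simp only [e, hs, h i a b]
  field_simp

/-- The quaternion rotation parameterization is surjective onto SO(3): every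
`R` with `Rᵀ R = I` and `det R = 1` equals `A(q)` for some unit quaternion `q = (qv, qs)`. -/
theorem quatRotMat_surjective_onto_SO3 (R : Matrix (Fin 3) (Fin 3) ℝ)
    (hR : Rᵀ * R = 1) (hdet : R.det = 1) :
    ∃ (qv : Fin 3 → ℝ) (qs : ℝ), qs ^ 2 + qv ⬝ᵥ qv = 1 ∧ R = quatRotMat qv qs := by
  have hR' : R * Rᵀ = 1 := mul_eq_one_comm.1 hR
  have hadj : R.adjugate = Rᵀ := by
    have : R.adjugate = Rᵀ * (R * R.adjugate) := by
      rw [← Matrix.mul_assoc, hR, Matrix.one_mul]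
    rw [this, Matrix.mul_adjugate, hdet, one_smul, Matrix.mul_one]
  rw [Matrix.adjugate_fin_three] at hadj
  have A := fun i j => congrFun (congrFun hR i) j
  have B := fun i j => congrFun (congrFun hR' i) j
  have C := fun i j => congrFun (congrFun hadj i) j
  clear hR hR' hadj hdet
  have a00 := A 0 0
  have a01 := A 0 1
  have a02 := A 0 2
  have a11 := A 1 1
  have a12 := A 1 2
  have a22 := A 2 2
  have b00 := B 0 0
  have b01 := B 0 1
  have b02 := B 0 2
  have b11 := B 1 1
  have b12 := B 1 2
  have b22 := B 2 2
  have c00 := C 0 0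
  have c01 := C 0 1
  have c02 := C 0 2
  have c10 := C 1 0
  have c11 := C 1 1
  have c12 := C 1 2
  have c20 := C 2 0
  have c21 := C 2 1
  have c22 := C 2 2
  clear A B C
  simp [Matrix.mul_apply, Fin.sum_univ_three] at a00 a01 a02 a11 a12 a22 b00 b01 b02 b11 b12 b22 c00 c01 c02 c10 c11 c12 c20 c21 c22
  obtain ⟨q, hq⟩ := rank_one_aux
    !![1 + R 0 0 + R 1 1 + R 2 2, R 1 2 - R 2 1, R 2 0 - R 0 2, R 0 1 - R 1 0;
       R 1 2 - R 2 1, 1 + R 0 0 - R 1 1 - R 2 2, R 0 1 + R 1 0, R 0 2 + R 2 0;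
       R 2 0 - R 0 2, R 0 1 + R 1 0, 1 - R 0 0 + R 1 1 - R 2 2, R 1 2 + R 2 1;
       R 0 1 - R 1 0, R 0 2 + R 2 0, R 1 2 + R 2 1, 1 - R 0 0 - R 1 1 + R 2 2]
    (by
      intro i a b
      fin_cases i <;> fin_cases a <;> fin_cases b <;> simp <;> linarith)
    (by simp; ring)
  have q00 := hq 0 0
  have q01 := hq 0 1
  have q02 := hq 0 2
  have q03 := hq 0 3
  have q11 := hq 1 1
  have q12 := hq 1 2
  have q13 := hq 1 3
  have q22 := hq 2 2
  have q23 := hq 2 3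
  have q33 := hq 3 3
  simp at q00 q01 q02 q03 q11 q12 q13 q22 q23 q33
  refine ⟨![q 1, q 2, q 3], q 0, ?_, ?_⟩
  · simp [dotProduct, Fin.sum_univ_three]
    linarith
  · ext i j
    fin_cases i <;> fin_cases j <;>
      simp [quatRotMat, crossMat, dotProduct, Fin.sum_univ_three, vecMulVec_apply] <;> linarith
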